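/- arXiv:2501.10450 — 5 statements merged into one kernel-verified Lean document; each statement's English description precedes it below -/
import Mathlib

section
/- Let E be a real normed vector space, U ⊆ E an open set, and ω : U → Λ a continuously differentiable map into the space Λ of continuous alternating bilinear forms on E, satisfying the closedness identity Dω(x)(u)(v,w) + Dω(x)(v)(w,u) + Dω(x)(w)(u,v) = 0 for all x ∈ U and u, v, w ∈ E. Suppose X, Y : U → E are differentiable vector fields that are null directions of ω, i.e. ω(x)(X(x), v) = 0 and ω(x)(Y(x), v) = 0 for all x ∈ U and v ∈ E. Then their Lie bracket [X,Y](x) := DY(x)(X(x)) − DX(x)(Y(x)) is also a null direction: ω(x)([X,Y](x), v) = 0 for all x ∈ U and v ∈ E. (The null directions of a closed presymplectic form — the infinitesimal gauge transformations — form an involutive distribution.) -/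
/-- If `x ↦ ω x (Z x)` vanishes near `x`, the product rule gives
`Dω(x)(u)(Z x) + ω(x)(DZ(x) u) = 0`. -/
theorem fderiv_apply_add_apply_fderiv_eq_zero
    {E F : Type*} [NormedAddCommGroup E] [NormedSpace ℝ E]
    [NormedAddCommGroup F] [NormedSpace ℝ F]
    {ω : E → (E →L[ℝ] F)} {Z : E → E} {x : E}
    (hω : DifferentiableAt ℝ ω x) (hZ : DifferentiableAt ℝ Z x)
    (h : (fun y => ω y (Z y)) =ᶠ[nhds x] fun _ => 0) (u : E) :
    fderiv ℝ ω x u (Z x) + ω x (fderiv ℝ Z x u) = 0 := by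
  have h₁ := (hω.hasFDerivAt.clm_apply hZ.hasFDerivAt).unique
    ((hasFDerivAt_const (0 : F) x).congr_of_eventuallyEq h)
  simpa [add_comm] using congrArg (fun L => L u) h₁

/-- A bilinear map that vanishes on the diagonal is antisymmetric. -/
theorem ContinuousLinearMap.apply_apply_eq_neg_of_apply_self
    {E : Type*} [NormedAddCommGroup E] [NormedSpace ℝ E]
    {B : E →L[ℝ] E →L[ℝ] ℝ} (h : ∀ v, B v v = 0) (v w : E) :
    B v w = -B w v := by
  have h₁ := h (v + w)
  simp only [map_add, add_apply, h] at h₁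
  linarith

/-- **Involutivity of the null directions of a closed presymplectic form.**
Let `E` be a real normed vector space, `U ⊆ E` open, and `ω` a continuously
differentiable assignment of continuous alternating bilinear forms on `E`,
satisfying the closedness identity.  If `X, Y` are differentiable vector fields
that are null directions of `ω` on `U`, then their Lie bracket
`[X,Y](x) = DY(x)(X(x)) − DX(x)(Y(x))` is also a null direction on `U`. -/
theorem null_directions_involutive
    {E : Type*} [NormedAddCommGroup E] [NormedSpace ℝ E]
    (U : Set E) (hU : IsOpen U)
    (ω : E → (E →L[ℝ] E →L[ℝ] ℝ))
    (hω : ContDiffOn ℝ 1 ω U)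
    (halt : ∀ x ∈ U, ∀ v : E, ω x v v = 0)
    (hclosed : ∀ x ∈ U, ∀ u v w : E,
      fderiv ℝ ω x u v w + fderiv ℝ ω x v w u + fderiv ℝ ω x w u v = 0)
    (X Y : E → E)
    (hX : ∀ x ∈ U, DifferentiableAt ℝ X x)
    (hY : ∀ x ∈ U, DifferentiableAt ℝ Y x)
    (hXnull : ∀ x ∈ U, ∀ v : E, ω x (X x) v = 0)
    (hYnull : ∀ x ∈ U, ∀ v : E, ω x (Y x) v = 0) :
    ∀ x ∈ U, ∀ v : E,
      ω x (fderiv ℝ Y x (X x) - fderiv ℝ X x (Y x)) v = 0 := by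
  intro x hx v
  have hUx : U ∈ nhds x := hU.mem_nhds hx
  have hd : DifferentiableAt ℝ ω x := (hω.contDiffAt hUx).differentiableAt (by simp)
  have hXd (u w : E) : fderiv ℝ ω x u (X x) w + ω x (fderiv ℝ X x u) w = 0 := by
    have h := fderiv_apply_add_apply_fderiv_eq_zero hd (hX x hx)
      (Filter.eventually_of_mem hUx fun y hy => ContinuousLinearMap.ext (hXnull y hy)) u
    simpa using congrArg (fun L => L w) h
  have hYd (u w : E) : fderiv ℝ ω x u (Y x) w + ω x (fderiv ℝ Y x u) w = 0 := by
    have h := fderiv_apply_add_apply_fderiv_eq_zero hd (hY x hx)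
      (Filter.eventually_of_mem hUx fun y hy => ContinuousLinearMap.ext (hYnull y hy)) u
    simpa using congrArg (fun L => L w) h
  have hDalt (u w : E) : fderiv ℝ ω x u w w = 0 := by
    have h := ((hd.hasFDerivAt.clm_apply (hasFDerivAt_const w x)).clm_apply
      (hasFDerivAt_const w x)).unique
      ((hasFDerivAt_const (0 : ℝ) x).congr_of_eventuallyEq
        (Filter.eventually_of_mem hUx fun y hy => halt y hy w))
    simpa using congrArg (fun L => L u) h
  have hc := hclosed x hx (X x) (Y x) v
  have hanti := ContinuousLinearMap.apply_apply_eq_neg_of_apply_self (hDalt (Y x)) v (X x)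
  have hω_anti := ContinuousLinearMap.apply_apply_eq_neg_of_apply_self (halt x hx)
    (fderiv ℝ X x v) (Y x)
  have hnull := hYnull x hx (fderiv ℝ X x v)
  rw [map_sub, sub_apply]
  linarith [hXd (Y x) v, hYd (X x) v, hXd v (Y x)]
end

section
/- Let E be a real normed vector space, Ω a continuous nondegenerate alternating bilinear form on E, and W₁, W₂ subspaces with E = W₁ ⊕ W₂ and Ω(w₁, w₂) = 0 for all w₁ ∈ W₁, w₂ ∈ W₂. Let f : E → ℝ be differentiable with Hamiltonian vector field X, i.e. Df(x)(v) = Ω(v, X(x)) for all x, v ∈ E. Then X(x) ∈ W₁ for all x ∈ E if and only if Df(x)(w) = 0 for all x ∈ E and all w ∈ W₂. (Linear model of Proposition 'Ss': the observables generating flows supported in Σ are exactly the regular observables supported on Σ, i.e. those invariant under all flows supported in the complement.) -/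
/-- A continuous alternating bilinear form is skew-symmetric. -/
theorem ContinuousLinearMap.apply_eq_neg_apply_of_alternating
    {E : Type*} [NormedAddCommGroup E] [NormedSpace ℝ E] {Ω : E →L[ℝ] E →L[ℝ] ℝ}
    (halt : ∀ v : E, Ω v v = 0) (v w : E) : Ω v w = -Ω w v := by
  have h := halt (v + w)
  simp only [map_add, add_apply, halt, zero_add, add_zero] at h
  linarith

/-- If `W₁` and `W₂` span and pair to zero under a nondegenerate alternating form `Ω`, then
every vector annihilated by `W₂` lies in `W₁`. -/
theorem Submodule.mem_of_forall_apply_eq_zero_of_sup_eq_top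
    {E : Type*} [NormedAddCommGroup E] [NormedSpace ℝ E] {Ω : E →L[ℝ] E →L[ℝ] ℝ}
    (halt : ∀ v : E, Ω v v = 0)
    (hnondeg : ∀ x : E, (∀ y : E, Ω x y = 0) → x = 0)
    {W₁ W₂ : Submodule ℝ E} (hspan : W₁ ⊔ W₂ = ⊤)
    (horth : ∀ w₁ ∈ W₁, ∀ w₂ ∈ W₂, Ω w₁ w₂ = 0)
    {x : E} (hx : ∀ w ∈ W₂, Ω w x = 0) : x ∈ W₁ := by
  have skew := ContinuousLinearMap.apply_eq_neg_apply_of_alternating halt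
  have decomp (y : E) : ∃ a ∈ W₁, ∃ b ∈ W₂, a + b = y :=
    Submodule.mem_sup.mp (hspan ▸ Submodule.mem_top)
  obtain ⟨a, ha, b, hb, rfl⟩ := decomp x
  suffices b = 0 by simpa [this] using ha
  refine hnondeg b fun y => ?_
  obtain ⟨c, hc, d, hd, rfl⟩ := decomp y
  have hdb := hx d hd
  rw [map_add, skew d a, horth a ha d hd, neg_zero, zero_add] at hdb
  rw [map_add, skew b c, skew b d, horth c hc b hb, hdb, neg_zero, add_zero]

/-- **Linear model of Proposition `Ss`.**  Let `Ω` be a continuous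
nondegenerate alternating bilinear form on a real normed space `E`, and let
`W₁, W₂` be complementary subspaces (`E = W₁ ⊕ W₂`) pairing to zero under
`Ω`.  If `f` is differentiable with Hamiltonian vector field `X` (i.e.
`Df(x)(v) = Ω(v, X(x))`), then `X` is valued in `W₁` iff the derivative of
`f` annihilates `W₂` everywhere. -/
theorem hamiltonian_field_in_subregion_iff_supported
    {E : Type*} [NormedAddCommGroup E] [NormedSpace ℝ E]
    (Ω : E →L[ℝ] E →L[ℝ] ℝ)
    (halt : ∀ v : E, Ω v v = 0)
    (hnondeg : ∀ x : E, (∀ y : E, Ω x y = 0) → x = 0)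
    (W₁ W₂ : Submodule ℝ E)
    (hdisj : W₁ ⊓ W₂ = ⊥)
    (hspan : W₁ ⊔ W₂ = ⊤)
    (horth : ∀ w₁ ∈ W₁, ∀ w₂ ∈ W₂, Ω w₁ w₂ = 0)
    (f : E → ℝ) (hf : Differentiable ℝ f)
    (X : E → E)
    (hX : ∀ x v : E, fderiv ℝ f x v = Ω v (X x)) :
    (∀ x : E, X x ∈ W₁) ↔ (∀ x : E, ∀ w ∈ W₂, fderiv ℝ f x w = 0) := by
  simp only [hX]
  refine ⟨fun h x w hw => ?_, fun h x =>
    Submodule.mem_of_forall_apply_eq_zero_of_sup_eq_top halt hnondeg hspan horth (h x)⟩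
  rw [ContinuousLinearMap.apply_eq_neg_apply_of_alternating halt, horth _ (h x) w hw, neg_zero]
end

section
/- Let E be a real normed vector space, Ω a continuous alternating bilinear form on E, and W ⊆ E a closed subspace. Suppose f, g : E → ℝ are twice continuously differentiable and admit differentiable Hamiltonian vector fields X, Y (so Df(x)(v) = Ω(v, X(x)) and Dg(x)(v) = Ω(v, Y(x)) for all x, v) with X(x) ∈ W and Y(x) ∈ W for all x ∈ E. Then the Poisson bracket h(x) := Ω(X(x), Y(x)) is differentiable, the Lie bracket [X,Y](x) := DY(x)(X(x)) − DX(x)(Y(x)) is a Hamiltonian vector field for h (i.e. Dh(x)(v) = Ω(v, [X,Y](x)) for all x, v), and [X,Y](x) ∈ W for all x. In particular, the functions admitting Hamiltonian vector fields valued in W are closed under Poisson bracket. (Linear model of the Corollary: the regular observables supported on Σ form a closed Poisson algebra.) -/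
/-- If a vector field takes values in a closed subspace, so does its derivative. -/
theorem fderiv_apply_mem_of_isClosed {E F : Type*} [NormedAddCommGroup E] [NormedSpace ℝ E]
    [NormedAddCommGroup F] [NormedSpace ℝ F] {W : Submodule ℝ F} (hW : IsClosed (W : Set F))
    {X : E → F} (hXW : ∀ x, X x ∈ W) {x : E} (hX : DifferentiableAt ℝ X x) (v : E) :
    fderiv ℝ X x v ∈ W := by
  have h := (hX.hasFDerivAt.hasLineDerivAt v).tendsto_slope_zero
  refine hW.mem_of_tendsto h (Filter.Eventually.of_forall fun t => ?_)
  exact W.smul_mem _ (W.sub_mem (hXW _) (hXW _))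

/-- The linearization of a Hamiltonian vector field is symmetric with respect to the form. -/
theorem hamiltonian_fderiv_symm {E : Type*} [NormedAddCommGroup E] [NormedSpace ℝ E]
    (Ω : E →L[ℝ] E →L[ℝ] ℝ) {f : E → ℝ} (hf : ContDiff ℝ 2 f) {X : E → E}
    (hXd : Differentiable ℝ X) (hX : ∀ x v : E, fderiv ℝ f x v = Ω v (X x)) (x u v : E) :
    Ω v (fderiv ℝ X x u) = Ω u (fderiv ℝ X x v) := by
  have hdf : Differentiable ℝ (fderiv ℝ f) :=
    (hf.fderiv_right (m := 1) (by norm_num)).differentiable (by norm_num)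
  have hsnd (u v : E) : fderiv ℝ (fderiv ℝ f) x u v = Ω v (fderiv ℝ X x u) := by
    have h₁ : HasFDerivAt (fun y => fderiv ℝ f y v) _ x :=
      (hdf x).hasFDerivAt.clm_apply (hasFDerivAt_const v x)
    have h₂ : HasFDerivAt (fun y => Ω v (X y)) _ x :=
      (Ω v).hasFDerivAt.comp x (hXd x).hasFDerivAt
    simp only [hX] at h₁
    simpa using DFunLike.congr_fun (h₁.unique h₂) u
  rw [← hsnd, ← hsnd]
  exact (hf.contDiffAt.isSymmSndFDerivAt (by simp)) u v

/-- **Linear model: regular observables supported on a subregion form a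
closed Poisson algebra.**  Let `Ω` be a continuous alternating bilinear form
on a real normed space `E` and `W ⊆ E` a closed subspace.  If `f, g` are
`C²` with differentiable Hamiltonian vector fields `X, Y` valued in `W`,
then the Poisson bracket `h(x) = Ω(X(x), Y(x))` is differentiable, the Lie
bracket `[X,Y]` is a Hamiltonian vector field for `h`, and `[X,Y]` is also
valued in `W`. -/
theorem poisson_algebra_of_subregion_observables
    {E : Type*} [NormedAddCommGroup E] [NormedSpace ℝ E]
    (Ω : E →L[ℝ] E →L[ℝ] ℝ)
    (halt : ∀ v : E, Ω v v = 0)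
    (W : Submodule ℝ E) (hW : IsClosed (W : Set E))
    (f g : E → ℝ) (hf : ContDiff ℝ 2 f) (hg : ContDiff ℝ 2 g)
    (X Y : E → E)
    (hXd : Differentiable ℝ X) (hYd : Differentiable ℝ Y)
    (hX : ∀ x v : E, fderiv ℝ f x v = Ω v (X x))
    (hY : ∀ x v : E, fderiv ℝ g x v = Ω v (Y x))
    (hXW : ∀ x : E, X x ∈ W) (hYW : ∀ x : E, Y x ∈ W) :
    Differentiable ℝ (fun x => Ω (X x) (Y x)) ∧
    (∀ x v : E, fderiv ℝ (fun x => Ω (X x) (Y x)) x v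
        = Ω v (fderiv ℝ Y x (X x) - fderiv ℝ X x (Y x))) ∧
    (∀ x : E, fderiv ℝ Y x (X x) - fderiv ℝ X x (Y x) ∈ W) := by
  have hanti (u v : E) : Ω u v = -Ω v u := by
    have h := halt (u + v)
    simp only [map_add, add_apply, halt] at h
    linarith
  have hd (x : E) : HasFDerivAt (fun x => Ω (X x) (Y x)) _ x :=
    (Ω.hasFDerivAt.comp x (hXd x).hasFDerivAt).clm_apply (hYd x).hasFDerivAt
  refine ⟨fun x => (hd x).differentiableAt, fun x v => ?_, fun x => ?_⟩
  · rw [(hd x).fderiv, map_sub, hamiltonian_fderiv_symm Ω hg hYd hY x (X x) v,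
      hamiltonian_fderiv_symm Ω hf hXd hX x (Y x) v, hanti (Y x)]
    simp
  · exact W.sub_mem (fderiv_apply_mem_of_isClosed hW hYW (hYd x) _)
      (fderiv_apply_mem_of_isClosed hW hXW (hXd x) _)
end

section
/- Let V be a vector space over a field K, Ω an alternating bilinear form on V with radical G, and V₁, V₂ subspaces with Ω(v₁, v₂) = 0 for all v₁ ∈ V₁ and v₂ ∈ V₂. Assume that V₁^⊥ ⊆ V₂ + G and V₂^⊥ ⊆ V₁ + G. Then the gauge-augmented subspaces V₁ + G and V₂ + G are symplectic complements of each other: (V₁ + G)^⊥ = V₂ + G and (V₂ + G)^⊥ = V₁ + G. (Linear model of Proposition 'complement_gauge': in a gauge theory, the spaces S′(Σ) = S(Σ) ⊕ 𝒢 and S′(Σ̄) = S(Σ̄) ⊕ 𝒢 of flows that are gauge outside the respective subregion are symplectic complements of each other, given that any flow symplectically annihilating all flows supported in one region restricts to a gauge transformation there.) -/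
/-- The symplectic complement of a subspace `W` with respect to a bilinear
form `Ω`: the set of vectors pairing to zero with every element of `W`. -/
def symplCompl {K V : Type*} [Field K] [AddCommGroup V] [Module K V]
    (Ω : V →ₗ[K] V →ₗ[K] K) (W : Submodule K V) : Submodule K V where
  carrier := {x | ∀ w ∈ W, Ω x w = 0}
  add_mem' := by
    intro a b ha hb w hw
    simp [map_add, ha w hw, hb w hw]
  zero_mem' := by
    intro w hw
    simp
  smul_mem' := by
    intro c a ha w hw
    simp [map_smul, ha w hw]

/-- The radical of a bilinear form `Ω`: vectors pairing to zero with
everything.  (Models the infinitesimal gauge transformations.) -/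
def radical {K V : Type*} [Field K] [AddCommGroup V] [Module K V]
    (Ω : V →ₗ[K] V →ₗ[K] K) : Submodule K V :=
  symplCompl Ω ⊤

theorem symplCompl_anti {K V : Type*} [Field K] [AddCommGroup V] [Module K V]
    (Ω : V →ₗ[K] V →ₗ[K] K) {W W' : Submodule K V} (h : W ≤ W') :
    symplCompl Ω W' ≤ symplCompl Ω W :=
  fun _ hx w hw => hx w (h hw)

theorem symplCompl_sup_radical {K V : Type*} [Field K] [AddCommGroup V] [Module K V]
    {Ω : V →ₗ[K] V →ₗ[K] K} (hΩ : Ω.IsAlt) (W : Submodule K V) :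
    symplCompl Ω (W ⊔ radical Ω) = symplCompl Ω W := by
  refine le_antisymm (symplCompl_anti Ω le_sup_left) fun x hx w hw => ?_
  obtain ⟨a, ha, g, hg, rfl⟩ := Submodule.mem_sup.mp hw
  rw [map_add, hx a ha, hΩ.isRefl g x (hg x Submodule.mem_top), add_zero]

theorem symplCompl_sup_radical_eq {K V : Type*} [Field K] [AddCommGroup V] [Module K V]
    {Ω : V →ₗ[K] V →ₗ[K] K} (hΩ : Ω.IsAlt) {W W' : Submodule K V}
    (horth : W' ≤ symplCompl Ω W) (h : symplCompl Ω W ≤ W' ⊔ radical Ω) :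
    symplCompl Ω (W ⊔ radical Ω) = W' ⊔ radical Ω := by
  rw [symplCompl_sup_radical hΩ]
  exact le_antisymm h (sup_le horth (symplCompl_anti Ω le_top))

/-- **Linear model of Proposition `complement_gauge`.**  If `V₁` and `V₂`
pair to zero under the alternating form `Ω`, and every vector symplectically
annihilating one of them lies in the other augmented by the radical `G`, then
the gauge-augmented subspaces `V₁ + G` and `V₂ + G` are symplectic
complements of each other. -/
theorem gauge_augmented_symplectic_complements
    {K V : Type*} [Field K] [AddCommGroup V] [Module K V]
    (Ω : V →ₗ[K] V →ₗ[K] K)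
    (halt : ∀ v : V, Ω v v = 0)
    (V₁ V₂ : Submodule K V)
    (horth : ∀ v₁ ∈ V₁, ∀ v₂ ∈ V₂, Ω v₁ v₂ = 0)
    (h₁ : symplCompl Ω V₁ ≤ V₂ ⊔ radical Ω)
    (h₂ : symplCompl Ω V₂ ≤ V₁ ⊔ radical Ω) :
    symplCompl Ω (V₁ ⊔ radical Ω) = V₂ ⊔ radical Ω ∧
    symplCompl Ω (V₂ ⊔ radical Ω) = V₁ ⊔ radical Ω := by
  have hΩ : Ω.IsAlt := halt
  exact ⟨symplCompl_sup_radical_eq hΩ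
      (fun v₂ hv₂ v₁ hv₁ => hΩ.isRefl v₁ v₂ (horth v₁ hv₁ v₂ hv₂)) h₁,
    symplCompl_sup_radical_eq hΩ horth h₂⟩
end

section
/- Let E be a real normed vector space and Ω a continuous alternating bilinear form on E with radical G := {x ∈ E : Ω(x, y) = 0 for all y ∈ E}. Let W₁, W₂ be subspaces with Ω(w₁, w₂) = 0 for all w₁ ∈ W₁, w₂ ∈ W₂, and assume W₁^⊥ ⊆ W₂ + G and W₂^⊥ ⊆ W₁ + G, where W^⊥ := {x : Ω(x, w) = 0 for all w ∈ W}. Let f : E → ℝ be differentiable and X : E → E a map with Df(x)(v) = Ω(v, X(x)) for all x, v ∈ E. Then X(x) ∈ W₁ + G for all x ∈ E if and only if Df(x)(w) = 0 for all x ∈ E and all w ∈ W₂ + G. (Linear model of Proposition 'Ssp': the observables generating flows in S′(Σ) = S(Σ) ⊕ 𝒢 are precisely the gauge-invariant regular observables supported on Σ; such observables generate field-dependent gauge transformations on the causal complement.) -/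
/-- **Linear model of Proposition `Ssp`.**  Let `Ω` be a continuous
alternating bilinear form on a real normed space `E` with radical `G`, and
let `W₁, W₂` be subspaces pairing to zero under `Ω`, such that every vector
symplectically annihilating one of them lies in the other augmented by `G`.
If `f` is differentiable with Hamiltonian vector field `X`, then `X` is
valued in `W₁ + G` iff the derivative of `f` annihilates `W₂ + G`
everywhere. -/
theorem hamiltonian_field_in_gauge_augmented_subregion_iff_supported
    {E : Type*} [NormedAddCommGroup E] [NormedSpace ℝ E]
    (Ω : E →L[ℝ] E →L[ℝ] ℝ)
    (halt : ∀ v : E, Ω v v = 0)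
    (G W₁ W₂ : Submodule ℝ E)
    (hG : ∀ x : E, x ∈ G ↔ ∀ y : E, Ω x y = 0)
    (horth : ∀ w₁ ∈ W₁, ∀ w₂ ∈ W₂, Ω w₁ w₂ = 0)
    (hperp₁ : ∀ x : E, (∀ w ∈ W₁, Ω x w = 0) → x ∈ W₂ ⊔ G)
    (hperp₂ : ∀ x : E, (∀ w ∈ W₂, Ω x w = 0) → x ∈ W₁ ⊔ G)
    (f : E → ℝ) (hf : Differentiable ℝ f)
    (X : E → E)
    (hX : ∀ x v : E, fderiv ℝ f x v = Ω v (X x)) :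
    (∀ x : E, X x ∈ W₁ ⊔ G) ↔ (∀ x : E, ∀ w ∈ W₂ ⊔ G, fderiv ℝ f x w = 0) := by
  have hneg : ∀ a b : E, Ω a b = -Ω b a := fun a b => by
    have h := halt (a + b)
    simp only [map_add, add_apply, halt] at h
    linarith
  constructor
  · intro h x w hw
    obtain ⟨w₂, hw₂, g, hg, rfl⟩ := Submodule.mem_sup.mp hw
    obtain ⟨w₁, hw₁, k, hk, hsum⟩ := Submodule.mem_sup.mp (h x)
    rw [hX, ← hsum]
    simp only [map_add, add_apply]
    rw [hneg w₂ w₁, horth w₁ hw₁ w₂ hw₂, (hG g).mp hg, (hG g).mp hg, hneg w₂ k, (hG k).mp hk]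
    simp
  · intro h x
    refine hperp₂ _ fun w hw => ?_
    rw [hneg, ← hX, h x w (Submodule.mem_sup_left hw), neg_zero]
end
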